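/- arXiv:2605.11676 — 3 statements merged into one kernel-verified Lean document; each statement's English description precedes it below -/
import Mathlib

section
/- Let K be a field with an absolute value ‖·‖ and let P = [1, a_1, …, a_N] ∈ ℙ^N(K) with a_1 ≠ 0. Set c = Σ_{i=1}^{N} log⁺‖a_i‖ + 2·log⁺‖a_1^{-1}‖ + log 4. Then for every x ∈ ℙ^N(K) one has λ_P^0(x) ≤ λ_P^1(x) + c (an inequality in [0, +∞]). In particular, the Weil functions λ_P^0 and λ_P^1 bound each other up to an additive constant. -/
open MvPolynomial
open scoped ENNReal NNReal

namespace Weil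

variable {K : Type*} [Field K]

/-- `log⁺ t = max (0, log t)`. -/
noncomputable def logPlus (t : ℝ) : ℝ := Real.log (max 1 t)

/-- An absolute value, bundled into `ℝ≥0`. -/
noncomputable def nnabs (v : AbsoluteValue K ℝ) (t : K) : NNReal := ⟨v t, v.nonneg t⟩

/-- The Weil function `λ_P^i` of the point `P = [a_0, …, a_n] ∈ P^(n-1)(K)` (with `a i ≠ 0`),
evaluated at the point with homogeneous coordinates `x`:
`λ_P^i(x) = -log⁻ max_{j ≠ i} ‖x_j/x_i - a_j/a_i‖` if `x i ≠ 0`, and `0` otherwise.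
It takes the value `⊤ = +∞` exactly when `x = P`. -/
noncomputable def weil {n : ℕ} (v : AbsoluteValue K ℝ) (a x : Fin n → K) (i : Fin n) : ℝ≥0∞ :=
  letI : DecidableEq K := Classical.decEq K
  letI : DecidableEq NNReal := Classical.decEq NNReal
  if x i = 0 then 0
  else
    if (Finset.univ.erase i).sup (fun j => nnabs v (x j / x i - a j / a i)) = 0 then ⊤
    else ENNReal.ofReal
      (- Real.log
        (((Finset.univ.erase i).sup fun j => nnabs v (x j / x i - a j / a i) : NNReal) : ℝ))

/-- The Weil function of the hyperplane at infinity, on affine points: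
`λ_{H_∞}(x) = log⁺ max_i ‖x_i‖`. -/
noncomputable def weilInf (v : AbsoluteValue K ℝ) {n : ℕ} (x : Fin n → K) : ℝ :=
  logPlus ((Finset.univ.sup fun i => nnabs v (x i) : NNReal) : ℝ)

end Weil

namespace Weil

variable {K : Type*} [Field K]

/-- `max_{j ≠ i} ‖x_j/x_i - a_j/a_i‖`, the distance from `x` to `P` in the `i`-th chart. -/
noncomputable def chartDist {n : ℕ} (v : AbsoluteValue K ℝ) (a x : Fin n → K) (i : Fin n) :
    ℝ≥0 :=
  (Finset.univ.erase i).sup fun j => nnabs v (x j / x i - a j / a i)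

theorem le_chartDist {n : ℕ} (v : AbsoluteValue K ℝ) (a x : Fin n → K) {i j : Fin n}
    (h : j ≠ i) : v (x j / x i - a j / a i) ≤ chartDist v a x i := by
  have := Finset.le_sup (f := fun j => nnabs v (x j / x i - a j / a i))
    (Finset.mem_erase.2 ⟨h, Finset.mem_univ j⟩)
  exact NNReal.coe_le_coe.2 this

theorem chartDist_le {n : ℕ} (v : AbsoluteValue K ℝ) (a x : Fin n → K) (i : Fin n) {r : ℝ}
    (hr : 0 ≤ r) (h : ∀ j, j ≠ i → v (x j / x i - a j / a i) ≤ r) :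
    (chartDist v a x i : ℝ) ≤ r := by
  have : chartDist v a x i ≤ ⟨r, hr⟩ :=
    Finset.sup_le fun j hj => h j (Finset.ne_of_mem_erase hj)
  exact NNReal.coe_le_coe.2 this

theorem weil_of_eq_zero {n : ℕ} (v : AbsoluteValue K ℝ) (a x : Fin n → K) {i : Fin n}
    (h : x i = 0) : weil v a x i = 0 := by
  simp [weil, h]

theorem weil_of_chartDist_eq_zero {n : ℕ} (v : AbsoluteValue K ℝ) (a x : Fin n → K) {i : Fin n}
    (h : x i ≠ 0) (hd : chartDist v a x i = 0) : weil v a x i = ⊤ := by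
  unfold weil
  rw [if_neg h]
  exact if_pos hd

theorem weil_of_chartDist_ne_zero {n : ℕ} (v : AbsoluteValue K ℝ) (a x : Fin n → K) {i : Fin n}
    (h : x i ≠ 0) (hd : chartDist v a x i ≠ 0) :
    weil v a x i = ENNReal.ofReal (-Real.log (chartDist v a x i)) := by
  unfold weil
  rw [if_neg h]
  exact if_neg hd

theorem weil_le_ofReal {n : ℕ} (v : AbsoluteValue K ℝ) (a x : Fin n → K) {i : Fin n}
    (h : x i ≠ 0) {c : ℝ} (hd : 1 ≤ Real.exp c * chartDist v a x i) :
    weil v a x i ≤ ENNReal.ofReal c := by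
  have h0 : chartDist v a x i ≠ 0 := by
    intro h0
    norm_num [h0] at hd
  have h0' : (chartDist v a x i : ℝ) ≠ 0 := NNReal.coe_ne_zero.2 h0
  rw [weil_of_chartDist_ne_zero v a x h h0]
  apply ENNReal.ofReal_le_ofReal
  have := Real.log_nonneg hd
  rw [Real.log_mul (Real.exp_ne_zero c) h0', Real.log_exp] at this
  linarith

theorem weil_le_weil_add {n : ℕ} (v : AbsoluteValue K ℝ) (a x : Fin n → K) {i j : Fin n}
    (hi : x i ≠ 0) (hj : x j ≠ 0) {c : ℝ}
    (hd : (chartDist v a x j : ℝ) ≤ Real.exp c * chartDist v a x i) :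
    weil v a x i ≤ weil v a x j + ENNReal.ofReal c := by
  by_cases hj0 : chartDist v a x j = 0
  · simp [weil_of_chartDist_eq_zero v a x hj hj0]
  have hj1 : (0 : ℝ) < chartDist v a x j := NNReal.coe_pos.2 (pos_iff_ne_zero.2 hj0)
  have hi0 : chartDist v a x i ≠ 0 := by
    intro h0
    rw [h0, NNReal.coe_zero, mul_zero] at hd
    linarith
  rw [weil_of_chartDist_ne_zero v a x hi hi0, weil_of_chartDist_ne_zero v a x hj hj0]
  refine le_trans (ENNReal.ofReal_le_ofReal ?_) ENNReal.ofReal_add_le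
  have := Real.log_le_log hj1 hd
  rw [Real.log_mul (Real.exp_ne_zero c) (NNReal.coe_ne_zero.2 hi0), Real.log_exp] at this
  linarith

theorem logPlus_nonneg (t : ℝ) : 0 ≤ logPlus t := Real.log_nonneg (le_max_left _ _)

theorem exp_logPlus (t : ℝ) : Real.exp (logPlus t) = max 1 t :=
  Real.exp_log (lt_of_lt_of_le one_pos (le_max_left _ _))

theorem le_exp_sum_logPlus {ι : Type*} [Fintype ι] (f : ι → ℝ) (i : ι) :
    f i ≤ Real.exp (∑ j, logPlus (f j)) := by
  calc f i ≤ Real.exp (logPlus (f i)) := by rw [exp_logPlus]; exact le_max_right _ _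
    _ ≤ _ := Real.exp_le_exp.2
      (Finset.single_le_sum (fun j _ => logPlus_nonneg (f j)) (Finset.mem_univ i))

/-- Change of affine chart: `y_j/y_1 - a_j/a_1` is controlled by `y_j - a_j` and `y_1 - a_1`
when `y_1` is close to `a_1 ≠ 0`. -/
theorem abv_div_sub_div_le (v : AbsoluteValue K ℝ) {y₁ b₁ y b : K} {d E B : ℝ} (hb₁ : b₁ ≠ 0)
    (hy₁ : v (y₁ - b₁) ≤ d) (hy : v (y - b) ≤ d) (hd : 2 * d ≤ v b₁)
    (hE₁ : v b₁ ≤ E) (hE : v b ≤ E) (hB : 1 ≤ B * v b₁) :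
    v (y / y₁ - b / b₁) ≤ 4 * E * B ^ 2 * d := by
  have hA : 0 < v b₁ := v.pos hb₁
  have hd0 : 0 ≤ d := (v.nonneg _).trans hy
  have hE0 : 0 ≤ E := (v.nonneg _).trans hE
  have htri : v b₁ ≤ v y₁ + v (y₁ - b₁) := by
    have := v.add_le y₁ (b₁ - y₁)
    rwa [add_sub_cancel, v.map_sub] at this
  have hvy₁ : v b₁ ≤ 2 * v y₁ := by linarith
  have hvy₁0 : 0 < v y₁ := by linarith
  have hy₁0 : y₁ ≠ 0 := v.pos_iff.1 hvy₁0
  have hid : y / y₁ - b / b₁ = ((y - b) * b₁ - b * (y₁ - b₁)) / (y₁ * b₁) := by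
    field_simp
    ring
  have hnum : v ((y - b) * b₁ - b * (y₁ - b₁)) ≤ 2 * E * d := by
    have h := v.sub_le_add ((y - b) * b₁) (b * (y₁ - b₁))
    rw [map_mul, map_mul] at h
    have h1 := mul_le_mul hy hE₁ hA.le hd0
    have h2 := mul_le_mul hE hy₁ (v.nonneg _) hE0
    linarith
  have hden : 1 ≤ 2 * B ^ 2 * (v y₁ * v b₁) := by
    have hB0 : 0 ≤ B := by
      by_contra! h
      nlinarith
    have h1 : 1 ≤ (B * v b₁) ^ 2 := one_le_pow₀ hB
    have h2 : B ^ 2 * v b₁ * v b₁ ≤ B ^ 2 * v b₁ * (2 * v y₁) := by gcongr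
    nlinarith
  rw [hid, map_div₀, map_mul, div_le_iff₀ (by positivity)]
  have := mul_le_mul_of_nonneg_left hden (by positivity : 0 ≤ 2 * E * d)
  linarith

end Weil

open Weil in
/-- Let `P = [1, a_1, …, a_N]` with `a_1 ≠ 0` and
`c = Σ_{i=1}^N log⁺‖a_i‖ + 2 log⁺‖a_1⁻¹‖ + log 4`.  Then `λ_P^0(x) ≤ λ_P^1(x) + c` for
every `x ∈ P^N(K)`; in particular `λ_P^0` and `λ_P^1` bound each other up to an additive
constant. -/
theorem statement9 {K : Type*} [Field K] (N : ℕ) (hN : 1 ≤ N) (v : AbsoluteValue K ℝ)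
    (a : Fin (N + 1) → K) (ha0 : a 0 = 1) (ha1 : a 1 ≠ 0) :
    ∀ x : Fin (N + 1) → K, x ≠ 0 →
      weil v a x 0 ≤ weil v a x 1 +
        ENNReal.ofReal ((∑ i : Fin N, logPlus (v (a i.succ))) +
          2 * logPlus (v ((a 1)⁻¹)) + Real.log 4) := by
  intro x _
  obtain ⟨m, rfl⟩ := Nat.exists_eq_add_of_le' hN
  by_cases hx0 : x 0 = 0
  · simp [weil_of_eq_zero v a x hx0]
  set S := ∑ i : Fin (m + 1), logPlus (v (a i.succ))
  set B := Real.exp (logPlus (v ((a 1)⁻¹))) with hB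
  set d : ℝ := (chartDist v a x 0 : ℝ) with hd
  have hA : 0 < v (a 1) := v.pos ha1
  have hE1 : 1 ≤ Real.exp S :=
    Real.one_le_exp (Finset.sum_nonneg fun i _ => logPlus_nonneg _)
  have hE : ∀ j, v (a j) ≤ Real.exp S := by
    intro j
    refine Fin.cases ?_ (fun i => ?_) j
    · simpa [ha0] using hE1
    · exact le_exp_sum_logPlus (fun i : Fin (m + 1) => v (a i.succ)) i
  have hB1 : 1 ≤ B := Real.one_le_exp (logPlus_nonneg _)
  have hBA : 1 ≤ B * v (a 1) := by
    have : (v (a 1))⁻¹ ≤ B := by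
      rw [hB, exp_logPlus, map_inv₀]
      exact le_max_right _ _
    calc 1 = (v (a 1))⁻¹ * v (a 1) := (inv_mul_cancel₀ hA.ne').symm
      _ ≤ _ := by gcongr
  have hC : Real.exp (S + 2 * logPlus (v ((a 1)⁻¹)) + Real.log 4) = 4 * Real.exp S * B ^ 2 := by
    rw [Real.exp_add, Real.exp_add, Real.exp_log (by norm_num), two_mul, Real.exp_add]
    ring
  have hdist : ∀ j, v (x j / x 0 - a j) ≤ d := by
    intro j
    by_cases hj : j = 0
    · subst hj
      simp [div_self hx0, ha0, hd]
    · simpa [ha0] using le_chartDist v a x hj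
  rcases le_or_gt (2 * d) (v (a 1)) with hnear | hfar
  · have hx1 : x 1 ≠ 0 := by
      intro hx1
      have h := hdist 1
      rw [hx1, zero_div, zero_sub, v.map_neg] at h
      linarith
    refine weil_le_weil_add v a x hx0 hx1 ?_
    rw [hC]
    refine chartDist_le v a x 1 (by positivity) fun j _ => ?_
    have h := abv_div_sub_div_le v ha1 (hdist 1) (hdist j) hnear (hE 1) (hE j) hBA
    rwa [div_div_div_cancel_right₀ hx0] at h
  · refine le_add_left (weil_le_ofReal v a x hx0 ?_)
    rw [hC]
    have h1 : 1 ≤ B * (2 * d) := hBA.trans (by gcongr)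
    have h2 : 1 ≤ Real.exp S * B := one_le_mul_of_one_le_of_one_le hE1 hB1
    have h3 := one_le_mul_of_one_le_of_one_le h1 h2
    nlinarith
end

section
/- Let K be a field with an absolute value ‖·‖, let A be an automorphism of ℙ^N_K given by an invertible (N+1)×(N+1) matrix over K, and let P ∈ ℙ^N(K). Fix indices i and j such that the i-th homogeneous coordinate of P and the j-th homogeneous coordinate of A(P) are nonzero. Then there exists a constant c ≥ 0 such that for every x ∈ ℙ^N(K) one has λ_P^i(x) ≤ λ_{A(P)}^j(A(x)) + c and λ_{A(P)}^j(A(x)) ≤ λ_P^i(x) + c (inequalities in [0, +∞]). -/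
open MvPolynomial
open scoped ENNReal NNReal

namespace Weil

lemma weil_le_weil_add_s10 {K : Type*} [Field K] {n : ℕ} (v : AbsoluteValue K ℝ)
    (a x b y : Fin n → K) (i j : Fin n) {C : ℝ} (hC : 1 ≤ C)
    (h : x i ≠ 0 → ∀ δ : ℝ, 0 ≤ δ → (∀ k, v (x k / x i - a k / a i) ≤ δ) → C * δ < 1 →
      y j ≠ 0 ∧ ∀ k, v (y k / y j - b k / b j) ≤ C * δ) (ha : a i ≠ 0) :
    weil v a x i ≤ weil v b y j + ENNReal.ofReal (Real.log C) := by
  classical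
  by_cases hx : x i = 0
  · simp [weil, hx]
  have hC0 : 0 < C := by linarith
  set d : ℝ≥0 := (Finset.univ.erase i).sup (fun k => nnabs v (x k / x i - a k / a i)) with hd
  set e : ℝ≥0 := (Finset.univ.erase j).sup (fun k => nnabs v (y k / y j - b k / b j)) with he
  have hwx : weil v a x i = if d = 0 then ⊤ else ENNReal.ofReal (-Real.log d) := by
    simp only [weil, hx, if_false, hd]
    congr
  have hdk : ∀ k, v (x k / x i - a k / a i) ≤ d := by
    intro k
    by_cases hk : k = i
    · subst hk
      simp [hx, ha]
    · have : nnabs v (x k / x i - a k / a i) ≤ d :=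
        Finset.le_sup (f := fun k => nnabs v (x k / x i - a k / a i)) (by simp [hk])
      exact_mod_cast this
  by_cases hCd : C * d < 1
  · obtain ⟨hy, hk⟩ := h hx d d.2 hdk hCd
    have hwy : weil v b y j = if e = 0 then ⊤ else ENNReal.ofReal (-Real.log e) := by
      simp only [weil, hy, if_false, he]
      congr
    have hed : (e : ℝ) ≤ C * d := by
      have : e ≤ ⟨C, hC0.le⟩ * d := Finset.sup_le fun k _ => by
        rw [← NNReal.coe_le_coe]
        exact hk k
      exact_mod_cast this
    by_cases he0 : e = 0
    · simp [hwy, he0]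
    have he1 : (0 : ℝ) < e := by exact_mod_cast pos_iff_ne_zero.mpr he0
    have hd1 : (0 : ℝ) < d := pos_of_mul_pos_right (he1.trans_le hed) hC0.le
    have hd0 : d ≠ 0 := by exact_mod_cast hd1.ne'
    rw [hwx, hwy, if_neg hd0, if_neg he0]
    refine le_trans (ENNReal.ofReal_le_ofReal ?_) ENNReal.ofReal_add_le
    have := Real.log_le_log he1 hed
    rw [Real.log_mul hC0.ne' hd1.ne'] at this
    linarith
  · push Not at hCd
    have hd1 : (0 : ℝ) < d := pos_of_mul_pos_right (one_pos.trans_le hCd) hC0.le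
    have hd0 : d ≠ 0 := by exact_mod_cast hd1.ne'
    rw [hwx, if_neg hd0]
    refine le_trans (ENNReal.ofReal_le_ofReal ?_) le_add_self
    have := Real.log_nonneg hCd
    rw [Real.log_mul hC0.ne' hd1.ne'] at this
    linarith

lemma exists_weil_le_weil_mulVec_add {K : Type*} [Field K] {n : ℕ} (v : AbsoluteValue K ℝ)
    (A : Matrix (Fin n) (Fin n) K) (p : Fin n → K) (i j : Fin n) (hpi : p i ≠ 0)
    (hpj : A.mulVec p j ≠ 0) :
    ∃ c : ℝ, 0 ≤ c ∧ ∀ x : Fin n → K,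
      weil v p x i ≤ weil v (A.mulVec p) (A.mulVec x) j + ENNReal.ofReal c := by
  set q : Fin n → K := (p i)⁻¹ • p with hq
  have hpq : ∀ k, A.mulVec p k = p i * A.mulVec q k := fun k => by
    simp [hq, Matrix.mulVec_smul, hpi]
  have hqj : A.mulVec q j ≠ 0 := fun h => hpj (by rw [hpq, h, mul_zero])
  set M : ℝ := ∑ k, ∑ l, v (A k l) with hM
  set B : ℝ := ∑ k, v (A.mulVec q k) with hB
  set β : ℝ := v (A.mulVec q j) with hβ
  have hM0 : 0 ≤ M := Finset.sum_nonneg fun k _ => Finset.sum_nonneg fun l _ => v.nonneg _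
  have hBk : ∀ k, v (A.mulVec q k) ≤ B := fun k =>
    Finset.single_le_sum (f := fun k => v (A.mulVec q k)) (fun k _ => v.nonneg _)
      (Finset.mem_univ k)
  have hβ0 : 0 < β := v.pos hqj
  have hB0 : 0 ≤ B := hβ0.le.trans (hBk j)
  have h1 : 0 ≤ 2 * M / β := by positivity
  have h2 : 0 ≤ 4 * B * M / β ^ 2 := by positivity
  set C : ℝ := 1 + 2 * M / β + 4 * B * M / β ^ 2 with hCdef
  have hC : 1 ≤ C := by linarith
  refine ⟨Real.log C, Real.log_nonneg hC, fun x => ?_⟩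
  refine weil_le_weil_add_s10 v p x _ _ i j hC (fun hx δ hδ hk hlt => ?_) hpi
  set y : Fin n → K := (x i)⁻¹ • x with hy
  have hxy : ∀ k, A.mulVec x k = x i * A.mulVec y k := fun k => by
    simp [hy, Matrix.mulVec_smul, hx]
  have hdiff : ∀ k, v (A.mulVec y k - A.mulVec q k) ≤ M * δ := fun k => by
    have hrow : ∑ l, v (A k l) ≤ M :=
      Finset.single_le_sum (f := fun k => ∑ l, v (A k l))
        (fun k _ => Finset.sum_nonneg fun l _ => v.nonneg _) (Finset.mem_univ k)
    have hsum : A.mulVec y k - A.mulVec q k = ∑ l, A k l * (x l / x i - p l / p i) := by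
      simp only [Matrix.mulVec, dotProduct, ← Finset.sum_sub_distrib]
      refine Finset.sum_congr rfl fun l _ => ?_
      simp only [hy, hq, Pi.smul_apply, smul_eq_mul]
      ring
    rw [hsum]
    calc v (∑ l, A k l * (x l / x i - p l / p i))
        ≤ ∑ l, v (A k l * (x l / x i - p l / p i)) := v.sum_le _ _
      _ ≤ ∑ l, v (A k l) * δ := Finset.sum_le_sum fun l _ => by
          rw [v.map_mul]
          exact mul_le_mul_of_nonneg_left (hk l) (v.nonneg _)
      _ = (∑ l, v (A k l)) * δ := by rw [Finset.sum_mul]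
      _ ≤ M * δ := mul_le_mul_of_nonneg_right hrow hδ
  have hsmall : 2 * (M * δ) < β := by
    have : 2 * M / β * δ < 1 :=
      lt_of_le_of_lt (mul_le_mul_of_nonneg_right (by linarith) hδ) hlt
    rw [div_mul_eq_mul_div, div_lt_one hβ0] at this
    linarith
  have hyj : β / 2 ≤ v (A.mulVec y j) := by
    have := v.sub_le (A.mulVec q j) (A.mulVec y j) 0
    rw [sub_zero, sub_zero, v.map_sub] at this
    linarith [hdiff j]
  have hyj0 : A.mulVec y j ≠ 0 := v.pos_iff.mp (by linarith)
  refine ⟨by rw [hxy]; exact mul_ne_zero hx hyj0, fun k => ?_⟩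
  have hquot : A.mulVec x k / A.mulVec x j - A.mulVec p k / A.mulVec p j =
      ((A.mulVec y k - A.mulVec q k) * A.mulVec q j -
        A.mulVec q k * (A.mulVec y j - A.mulVec q j)) / (A.mulVec y j * A.mulVec q j) := by
    rw [hxy, hxy, hpq, hpq, mul_div_mul_left _ _ hx, mul_div_mul_left _ _ hpi,
      div_sub_div _ _ hyj0 hqj]
    ring
  have hnum : v ((A.mulVec y k - A.mulVec q k) * A.mulVec q j -
      A.mulVec q k * (A.mulVec y j - A.mulVec q j)) ≤ 2 * B * (M * δ) := by
    refine (v.sub_le_add _ _).trans ?_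
    rw [v.map_mul, v.map_mul]
    have := mul_le_mul (hdiff k) (hBk j) (v.nonneg _) (by positivity)
    have := mul_le_mul (hBk k) (hdiff j) (v.nonneg _) hB0
    linarith
  rw [hquot, map_div₀, v.map_mul]
  calc _ ≤ 2 * B * (M * δ) / (β / 2 * β) :=
        div_le_div₀ (by positivity) hnum (by positivity)
          (mul_le_mul_of_nonneg_right hyj hβ0.le)
    _ = 4 * B * M / β ^ 2 * δ := by field_simp; ring
    _ ≤ C * δ := mul_le_mul_of_nonneg_right (by linarith) hδ

end Weil

open Weil in
/-- For an automorphism `A` of `P^N_K` given by an invertible matrix and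
a point `P` (with suitable nonvanishing coordinates `i` of `P` and `j` of `A(P)`), the Weil
functions `λ_P^i(x)` and `λ_{A(P)}^j(A(x))` bound each other up to an additive constant. -/
theorem statement10 {K : Type*} [Field K] (N : ℕ) (v : AbsoluteValue K ℝ)
    (A : Matrix (Fin (N + 1)) (Fin (N + 1)) K) (hA : IsUnit A.det)
    (p : Fin (N + 1) → K) (hp : p ≠ 0)
    (i j : Fin (N + 1)) (hpi : p i ≠ 0) (hpj : A.mulVec p j ≠ 0) :
    ∃ c : ℝ, 0 ≤ c ∧ ∀ x : Fin (N + 1) → K, x ≠ 0 →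
      weil v p x i ≤ weil v (A.mulVec p) (A.mulVec x) j + ENNReal.ofReal c ∧
      weil v (A.mulVec p) (A.mulVec x) j ≤ weil v p x i + ENNReal.ofReal c := by
  obtain ⟨c, hc, h⟩ := exists_weil_le_weil_mulVec_add v A p i j hpi hpj
  have hinv : ∀ x, A⁻¹.mulVec (A.mulVec x) = x := fun x => by
    rw [Matrix.mulVec_mulVec, Matrix.nonsing_inv_mul A hA, Matrix.one_mulVec]
  obtain ⟨c', hc', h'⟩ := exists_weil_le_weil_mulVec_add v A⁻¹ (A.mulVec p) j i hpj
    (by rwa [hinv])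
  refine ⟨max c c', le_max_of_le_left hc, fun x _ => ⟨(h x).trans ?_, ?_⟩⟩
  · gcongr
    exact le_max_left _ _
  · have hx := h' (A.mulVec x)
    rw [hinv, hinv] at hx
    refine hx.trans ?_
    gcongr
    exact le_max_right _ _
end

section
/- Let K be a field with an absolute value ‖·‖, let V ⊆ ℙ^N_K be a proper Zariski-closed subset, and let P ∈ ℙ^N(K) with P ∉ V; fix an index i such that the i-th homogeneous coordinate of P is nonzero. Then there exists a constant c ≥ 0 such that every x ∈ ℙ^N(K) with λ_P^i(x) ≥ c satisfies x ∉ V(K). -/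
open MvPolynomial
open scoped ENNReal NNReal

/-- A homogeneous polynomial of degree `m` scales by `c ^ m` under scaling of its arguments. -/
theorem MvPolynomial.IsHomogeneous.eval_smul_eq {σ R : Type*} [CommSemiring R]
    {q : MvPolynomial σ R} {m : ℕ} (hq : q.IsHomogeneous m) (c : R) (y : σ → R) :
    eval (c • y) q = c ^ m * eval y q := by
  simp only [eval_eq, Finset.mul_sum]
  refine Finset.sum_congr rfl fun d hd => ?_
  have hdeg : ∑ j ∈ d.support, d j = m := by
    simp [← hq (mem_support_iff.mp hd), Finsupp.weight_apply, Finsupp.sum]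
  simp only [Pi.smul_apply, smul_eq_mul, mul_pow, Finset.prod_mul_distrib,
    Finset.prod_pow_eq_pow_sum, hdeg]
  ring

/-- The nonvanishing locus of a polynomial is open for the topology of an absolute value. -/
theorem AbsoluteValue.exists_forall_lt_eval_ne_zero {K σ : Type*} [Field K] [Fintype σ]
    (v : AbsoluteValue K ℝ) (q : MvPolynomial σ K) (a : σ → K) (ha : eval a q ≠ 0) :
    ∃ δ : ℝ, 0 < δ ∧ ∀ y : σ → K, (∀ j, v (y j - a j) < δ) → eval y q ≠ 0 := by
  let : NormedField K := v.toNormedField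
  have hcont : Continuous fun y : σ → K => eval y q := MvPolynomial.continuous_eval q
  obtain ⟨δ, hδ, h⟩ := Metric.eventually_nhds_iff.mp (hcont.continuousAt.eventually_ne ha)
  refine ⟨δ, hδ, fun y hy => h ((dist_pi_lt_iff hδ).mpr fun j => ?_)⟩
  rw [dist_eq_norm]
  exact hy j

namespace Weil

/-- A large Weil function forces the affine coordinates to be close. -/
theorem le_exp_neg_of_ofReal_le_weil {K : Type*} [Field K] {n : ℕ} (v : AbsoluteValue K ℝ)
    (a x : Fin n → K) (i : Fin n) {c : ℝ} (hc : 0 < c) (h : ENNReal.ofReal c ≤ weil v a x i) :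
    x i ≠ 0 ∧ ∀ j, j ≠ i → v (x j / x i - a j / a i) ≤ Real.exp (-c) := by
  classical
  unfold weil at h
  split_ifs at h with hx hs
  · simp [hc.not_ge] at h
  all_goals
    refine ⟨hx, fun j hj => ?_⟩
    have hle := Finset.le_sup (f := fun j => nnabs v (x j / x i - a j / a i))
      (Finset.mem_erase.mpr ⟨hj, Finset.mem_univ j⟩)
  · have hle' : v (x j / x i - a j / a i) ≤ 0 := by
      have := hle.trans_eq (by convert hs)
      exact_mod_cast this
    exact hle'.trans (Real.exp_pos _).le
  · have hpos := pos_iff_ne_zero.mpr hs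
    have hlog := (ENNReal.ofReal_le_ofReal_iff' .. |>.mp h).resolve_right hc.not_ge
    refine (NNReal.coe_le_coe.mpr hle).trans ?_
    refine (Real.log_le_iff_le_exp (NNReal.coe_pos.mpr ?_)).mp ?_
    · convert hpos
    · convert le_neg_of_le_neg hlog

end Weil

open Weil in
/-- Let `V ⊆ P^N_K` be the Zariski-closed set cut out by a family `T` of
homogeneous polynomials and let `P ∉ V(K)`.  Then there is `c ≥ 0` such that every point
`x ∈ P^N(K)` with `λ_P^i(x) ≥ c` lies outside `V(K)`. -/
theorem statement13 {K : Type*} [Field K] (N : ℕ) (v : AbsoluteValue K ℝ)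
    (T : Set (MvPolynomial (Fin (N + 1)) K)) (hT : ∀ q ∈ T, ∃ m, q.IsHomogeneous m)
    (p : Fin (N + 1) → K) (hp : p ≠ 0) (i : Fin (N + 1)) (hpi : p i ≠ 0)
    (hPV : ∃ q ∈ T, MvPolynomial.eval p q ≠ 0) :
    ∃ c : ℝ, 0 ≤ c ∧ ∀ x : Fin (N + 1) → K, x ≠ 0 →
      ENNReal.ofReal c ≤ weil v p x i → ∃ q ∈ T, MvPolynomial.eval x q ≠ 0 := by
  obtain ⟨q, hqT, hq⟩ := hPV
  obtain ⟨m, hm⟩ := hT q hqT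
  have eval_eq_mul : ∀ x : Fin (N + 1) → K, x i ≠ 0 →
      eval x q = x i ^ m * eval (fun j => x j / x i) q := fun x hx => by
    rw [← hm.eval_smul_eq]
    congr 2
    ext j
    simp [mul_div_cancel₀ _ hx]
  obtain ⟨δ, hδ, h⟩ := v.exists_forall_lt_eval_ne_zero q (fun j => p j / p i)
    (right_ne_zero_of_mul (eval_eq_mul p hpi ▸ hq))
  refine ⟨|Real.log δ| + 1, by positivity, fun x _ hx => ⟨q, hqT, ?_⟩⟩
  obtain ⟨hxi, hclose⟩ := le_exp_neg_of_ofReal_le_weil v p x i (by positivity) hx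
  rw [eval_eq_mul x hxi]
  refine mul_ne_zero (pow_ne_zero m hxi) (h _ fun j => ?_)
  by_cases hj : j = i
  · simpa [hj, hxi, hpi] using hδ
  · refine (hclose j hj).trans_lt ((Real.lt_log_iff_exp_lt hδ).mp ?_)
    linarith [neg_abs_le (Real.log δ)]
end
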